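/- arXiv:2510.19308 — 3 statements merged into one kernel-verified Lean document; each statement's English description precedes it below -/
import Mathlib

section
/- For every homogeneous element G ∈ S of degree 6 and every D ∈ S with 2D = φ(f+2G) − (f+2G)², one has the congruence ρ(f·D) ≡ s₁²(s₁s₂+s₃)·(s₁⁴ + g₁² + g₂²)·x³y³z³w² modulo the ideal m^[4] = (x⁴, y⁴, z⁴, w⁴) of k[x,y,z,w], where g₁ and g₂ denote the coefficients of the monomials xzw and yzw respectively in ρ(G). -/
open MvPolynomial

/-- The second elementary symmetric function of the entries of a list. -/
def pairSum {R : Type*} [CommRing R] : List R → R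
  | [] => 0
  | m :: l => m * l.sum + pairSum l

theorem sum_sq_eq_add_two_mul_pairSum {R : Type*} [CommRing R] (l : List R) :
    l.sum ^ 2 = (l.map (· ^ 2)).sum + 2 * pairSum l := by
  induction l with
  | nil => simp [pairSum]
  | cons m l ih =>
    simp only [List.sum_cons, List.map_cons, pairSum]
    linear_combination ih

theorem map_pairSum {R S : Type*} [CommRing R] [CommRing S] (g : R →+* S) (l : List R) :
    g (pairSum l) = pairSum (l.map g) := by
  induction l with
  | nil => simp [pairSum]
  | cons m l ih => simp [pairSum, ih, map_list_sum]

/-- If `φ` squares every entry of `l`, the value at `l.sum + 2 * G` of the `δ`-structure attached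
to the Frobenius lift `φ` is determined by `pairSum l`, `φ G` and a multiple of `2`. -/
theorem eq_of_two_mul_eq_map_sub_sq {R : Type*} [CommRing R] [NoZeroDivisors R]
    (h2 : (2 : R) ≠ 0) (φ : R →+* R) (l : List R) (hl : ∀ m ∈ l, φ m = m ^ 2) (G D : R)
    (hD : 2 * D = φ (l.sum + 2 * G) - (l.sum + 2 * G) ^ 2) :
    D = φ G - pairSum l - 2 * (l.sum * G + G ^ 2) := by
  apply mul_left_cancel₀ h2
  have h := sum_sq_eq_add_two_mul_pairSum l
  have hmap : φ l.sum = (l.map (· ^ 2)).sum := by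
    rw [map_list_sum, List.map_congr_left hl]
  rw [hD, map_add, map_mul, map_ofNat, hmap]
  linear_combination -h

theorem frobenius_teichmuller {k : Type*} [CommRing k] [CharP k 2] (α : k) :
    WittVector.frobenius (WittVector.teichmuller 2 α) = WittVector.teichmuller 2 α ^ 2 := by
  have h : WittVector.teichmuller 2 α ^ 2 = WittVector.teichmuller 2 (α ^ 2) :=
    (map_pow _ _ _).symm
  rw [h]
  ext n
  rw [WittVector.coeff_frobenius_charP]
  rcases n.eq_zero_or_pos with rfl | hn
  · simp only [WittVector.teichmuller_coeff_zero]
  · simp only [WittVector.teichmuller_coeff_pos _ _ _ hn, ne_eq, two_ne_zero, not_false_eq_true,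
      zero_pow]

theorem map_frobeniusLift {k σ : Type*} [CommRing k] [CharP k 2]
    (φ : MvPolynomial σ (WittVector 2 k) →+* MvPolynomial σ (WittVector 2 k))
    (hφC : ∀ α : WittVector 2 k, φ (C α) = C (WittVector.frobenius α))
    (hφX : ∀ i, φ (X i) = X i ^ 2)
    (r : WittVector 2 k →+* k) (hr : ∀ α : WittVector 2 k, r α = α.coeff 0)
    (G : MvPolynomial σ (WittVector 2 k)) :
    MvPolynomial.map r (φ G) = MvPolynomial.map r G ^ 2 := by
  have h : (MvPolynomial.map r).comp φ =
      (frobenius (MvPolynomial σ k) 2).comp (MvPolynomial.map r) := by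
    refine MvPolynomial.ringHom_ext (fun α => ?_) (fun i => ?_)
    · simp [hφC, hr, WittVector.coeff_frobenius_charP, frobenius_def]
    · simp [hφX, frobenius_def]
  exact RingHom.congr_fun h G

theorem pairSum_eq_of_fourth_powers_eq_zero {R : Type*} [CommRing R] (x y z : R)
    (hx : x ^ 4 = 0) (hy : y ^ 4 = 0) (hz : z ^ 4 = 0)
    (t1 t2 t3 t4 t5 t6 t7 t8 t9 t10 t11 t12 : R) :
    pairSum [t1 * z ^ 3, t2 * y ^ 2 * z ^ 2, t3 * x * y * z ^ 2, t4 * x ^ 2 * z ^ 2,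
      t5 * x * y ^ 3 * z, t6 * x ^ 2 * y ^ 2 * z, t7 * x ^ 3 * y * z, t8 * x ^ 4 * z,
      t9 * y ^ 6, t10 * x ^ 2 * y ^ 4, t11 * x ^ 4 * y ^ 2, t12 * x ^ 6] =
    (t2 * t7 + t3 * t6 + t4 * t5) * (x ^ 3 * y ^ 3 * z ^ 3) := by
  simp only [pairSum, List.sum_cons, List.sum_nil]
  linear_combination
    (t1 * t11 * y ^ 2 * z ^ 3 + t1 * t12 * x ^ 2 * z ^ 3 + t2 * t8 * y ^ 2 * z ^ 3 + t2 * t12 *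
      x ^ 2 * y ^ 2 * z ^ 2 + t3 * t7 * y ^ 2 * z ^ 3 + t3 * t8 * x * y * z ^ 3 + t3 * t11 * x *
      y ^ 3 * z ^ 2 + t3 * t12 * x ^ 3 * y * z ^ 2 + t4 * t6 * y ^ 2 * z ^ 3 + t4 * t7 * x * y *
      z ^ 3 + t4 * t8 * x ^ 2 * z ^ 3 + t4 * t11 * x ^ 2 * y ^ 2 * z ^ 2 + t4 * t12 * x ^ 4 * z
      ^ 2 + t5 * t8 * x * y ^ 3 * z ^ 2 + t5 * t12 * x ^ 3 * y ^ 3 * z + t6 * t7 * x * y ^ 3 * z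
      ^ 2 + t6 * t8 * x ^ 2 * y ^ 2 * z ^ 2 + t6 * t12 * x ^ 4 * y ^ 2 * z + t7 * t8 * x ^ 3 * y
      * z ^ 2 + t7 * t11 * x ^ 3 * y ^ 3 * z + t7 * t12 * x ^ 5 * y * z + t8 * t11 * x ^ 4 * y ^
      2 * z + t8 * t12 * x ^ 6 * z + t11 * t12 * x ^ 6 * y ^ 2) * hx +
    (t1 * t9 * y ^ 2 * z ^ 3 + t1 * t10 * x ^ 2 * z ^ 3 + t2 * t5 * x * y * z ^ 3 + t2 * t6 * x
      ^ 2 * z ^ 3 + t2 * t9 * y ^ 4 * z ^ 2 + t2 * t10 * x ^ 2 * y ^ 2 * z ^ 2 + t2 * t11 * x ^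
      4 * z ^ 2 + t3 * t5 * x ^ 2 * z ^ 3 + t3 * t9 * x * y ^ 3 * z ^ 2 + t3 * t10 * x ^ 3 * y *
      z ^ 2 + t4 * t9 * x ^ 2 * y ^ 2 * z ^ 2 + t4 * t10 * x ^ 4 * z ^ 2 + t5 * t6 * x ^ 3 * y *
      z ^ 2 + t5 * t7 * x ^ 4 * z ^ 2 + t5 * t9 * x * y ^ 5 * z + t5 * t10 * x ^ 3 * y ^ 3 * z +
      t5 * t11 * x ^ 5 * y * z + t6 * t9 * x ^ 2 * y ^ 4 * z + t6 * t10 * x ^ 4 * y ^ 2 * z + t6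
      * t11 * x ^ 6 * z + t7 * t9 * x ^ 3 * y ^ 3 * z + t7 * t10 * x ^ 5 * y * z + t8 * t9 * x ^
      4 * y ^ 2 * z + t8 * t10 * x ^ 6 * z + t9 * t10 * x ^ 2 * y ^ 6 + t9 * t11 * x ^ 4 * y ^ 4
      + t9 * t12 * x ^ 6 * y ^ 2 + t10 * t11 * x ^ 6 * y ^ 2 + t10 * t12 * x ^ 8) * hy +
    (t1 * t2 * y ^ 2 * z + t1 * t3 * x * y * z + t1 * t4 * x ^ 2 * z + t1 * t5 * x * y ^ 3 + t1
      * t6 * x ^ 2 * y ^ 2 + t1 * t7 * x ^ 3 * y + t1 * t8 * x ^ 4 + t2 * t3 * x * y ^ 3 + t2 *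
      t4 * x ^ 2 * y ^ 2 + t3 * t4 * x ^ 3 * y) * hz

/-- The key congruence in an arbitrary ring of characteristic 2 in which the fourth powers
of the variables vanish; `h` is the part of the perturbation with zero square. -/
theorem mul_pairSum_add_sq_eq {R : Type*} [CommRing R] (h2 : (2 : R) = 0) (x y z w : R)
    (hx : x ^ 4 = 0) (hy : y ^ 4 = 0) (hz : z ^ 4 = 0) (hw : w ^ 4 = 0)
    (t1 t2 t3 t4 t5 t6 t7 t8 t9 t10 t11 t12 p q h : R) (hh : h ^ 2 = 0) (l : List R)
    (hl : l = [w ^ 2, t1 * z ^ 3, t2 * y ^ 2 * z ^ 2, t3 * x * y * z ^ 2, t4 * x ^ 2 * z ^ 2,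
      t5 * x * y ^ 3 * z, t6 * x ^ 2 * y ^ 2 * z, t7 * x ^ 3 * y * z, t8 * x ^ 4 * z,
      t9 * y ^ 6, t10 * x ^ 2 * y ^ 4, t11 * x ^ 4 * y ^ 2, t12 * x ^ 6]) :
    l.sum * ((p * (x * z * w) + q * (y * z * w) + h) ^ 2 - pairSum l) =
      (t2 * t7 + t3 * t6 + t4 * t5 + p ^ 2 * t5 + q ^ 2 * t7) *
        (x ^ 3 * y ^ 3 * z ^ 3 * w ^ 2) := by
  rw [hl, pairSum, pairSum_eq_of_fourth_powers_eq_zero x y z hx hy hz, List.sum_cons]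
  generalize hF : List.sum [t1 * z ^ 3, t2 * y ^ 2 * z ^ 2, t3 * x * y * z ^ 2,
    t4 * x ^ 2 * z ^ 2, t5 * x * y ^ 3 * z, t6 * x ^ 2 * y ^ 2 * z, t7 * x ^ 3 * y * z,
    t8 * x ^ 4 * z, t9 * y ^ 6, t10 * x ^ 2 * y ^ 4, t11 * x ^ 4 * y ^ 2, t12 * x ^ 6] = F
  simp only [List.sum_cons, List.sum_nil] at hF
  have hFP : ∃ P Q S, F = x ^ 2 * P + y ^ 2 * Q + z ^ 2 * S :=
    ⟨t6 * y ^ 2 * z + t7 * x * y * z + t8 * x ^ 2 * z + t11 * x ^ 2 * y ^ 2 + t12 * x ^ 4,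
      t5 * x * y * z + t9 * y ^ 4 + t10 * x ^ 2 * y ^ 2,
      t1 * z + t2 * y ^ 2 + t3 * x * y + t4 * x ^ 2, by rw [← hF]; ring⟩
  have hxz : F * (x ^ 2 * z ^ 2) = t5 * (x ^ 3 * y ^ 3 * z ^ 3) := by
    rw [← hF]
    linear_combination
      (t6 * y ^ 2 * z ^ 3 + t7 * x * y * z ^ 3 + t8 * x ^ 2 * z ^ 3 + t10 * y ^ 4 * z ^ 2
        + t11 * x ^ 2 * y ^ 2 * z ^ 2 + t12 * x ^ 4 * z ^ 2) * hx
      + t9 * x ^ 2 * y ^ 2 * z ^ 2 * hy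
      + (t1 * x ^ 2 * z + t2 * x ^ 2 * y ^ 2 + t3 * x ^ 3 * y + t4 * x ^ 4) * hz
  have hyz : F * (y ^ 2 * z ^ 2) = t7 * (x ^ 3 * y ^ 3 * z ^ 3) := by
    rw [← hF]
    linear_combination
      (t8 * y ^ 2 * z ^ 3 + t11 * y ^ 4 * z ^ 2 + t12 * x ^ 2 * y ^ 2 * z ^ 2) * hx
      + (t5 * x * y * z ^ 3 + t6 * x ^ 2 * z ^ 3 + t9 * y ^ 4 * z ^ 2
        + t10 * x ^ 2 * y ^ 2 * z ^ 2) * hy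
      + (t1 * y ^ 2 * z + t2 * y ^ 4 + t3 * x * y ^ 3 + t4 * x ^ 2 * y ^ 2) * hz
  obtain ⟨P, Q, S, hPQS⟩ := hFP
  have hFxyz : F * (x ^ 3 * y ^ 3 * z ^ 3) = 0 := by
    rw [hPQS]
    linear_combination x * P * y ^ 3 * z ^ 3 * hx + y * Q * x ^ 3 * z ^ 3 * hy
      + z * S * x ^ 3 * y ^ 3 * hz
  have hF2 : F ^ 2 = 0 := by
    rw [hPQS]
    linear_combination P ^ 2 * hx + Q ^ 2 * hy + S ^ 2 * hz
      + (x ^ 2 * P * y ^ 2 * Q + x ^ 2 * P * z ^ 2 * S + y ^ 2 * Q * z ^ 2 * S) * h2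
  have hg : (p * (x * z * w) + q * (y * z * w) + h) ^ 2 =
      p ^ 2 * (x ^ 2 * z ^ 2 * w ^ 2) + q ^ 2 * (y ^ 2 * z ^ 2 * w ^ 2) := by
    linear_combination hh + (p * (x * z * w) * (q * (y * z * w)) + p * (x * z * w) * h
      + q * (y * z * w) * h) * h2
  rw [hg]
  linear_combination p ^ 2 * w ^ 2 * hxz + q ^ 2 * w ^ 2 * hyz
    + (p ^ 2 * x ^ 2 * z ^ 2 + q ^ 2 * y ^ 2 * z ^ 2 - F) * hw - w ^ 2 * hF2
    - (t2 * t7 + t3 * t6 + t4 * t5) * hFxyz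
    - (t2 * t7 + t3 * t6 + t4 * t5) * (x ^ 3 * y ^ 3 * z ^ 3 * w ^ 2) * h2

/-- In characteristic 2, squaring sends the ideal of squares of variables to that of fourth
powers. -/
theorem sq_mem_span_fourth_powers {k : Type*} [CommRing k] [CharP k 2]
    (h : MvPolynomial (Fin 4) k)
    (hh : h ∈ Ideal.span ((fun s => monomial s (1 : k)) ''
      Set.range fun i : Fin 4 => Finsupp.single i 2)) :
    h ^ 2 ∈ Ideal.span
      ({X 0 ^ 4, X 1 ^ 4, X 2 ^ 4, X 3 ^ 4} : Set (MvPolynomial (Fin 4) k)) := by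
  suffices H : Ideal.span ((fun s => monomial s (1 : k)) ''
      Set.range fun i : Fin 4 => Finsupp.single i 2) ≤ (Ideal.span
      ({X 0 ^ 4, X 1 ^ 4, X 2 ^ 4, X 3 ^ 4} : Set (MvPolynomial (Fin 4) k))).comap
        (frobenius (MvPolynomial (Fin 4) k) 2) from H hh
  rw [Ideal.span_le]
  rintro _ ⟨_, ⟨i, rfl⟩, rfl⟩
  simp only [SetLike.mem_coe, Ideal.mem_comap, frobenius_def, ← X_pow_eq_monomial, ← pow_mul]
  apply Ideal.subset_span
  fin_cases i <;> simp

/-- A sextic form in variables of weights `1, 1, 2, 3` agrees with its `xzw` and `yzw` terms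
modulo the squares of the variables. -/
theorem sub_mem_span_squares {k : Type*} [CommRing k] (g : MvPolynomial (Fin 4) k)
    (hg : IsWeightedHomogeneous (![1, 1, 2, 3] : Fin 4 → ℕ) g 6) :
    g - (C (coeff (Finsupp.single 0 1 + Finsupp.single 2 1 + Finsupp.single 3 1) g)
          * (X 0 * X 2 * X 3)
        + C (coeff (Finsupp.single 1 1 + Finsupp.single 2 1 + Finsupp.single 3 1) g)
          * (X 1 * X 2 * X 3))
      ∈ Ideal.span ((fun s => monomial s (1 : k)) ''
        Set.range fun i : Fin 4 => Finsupp.single i 2) := by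
  classical
  rw [mem_ideal_span_monomial_image]
  intro d hd
  by_contra! hcon
  have hlt : ∀ i, d i < 2 := by
    intro i
    by_contra! hi
    exact hcon _ ⟨i, rfl⟩ (by simpa using hi)
  rw [mem_support_iff] at hd
  have hmon (i : Fin 4) : (X i * X 2 * X 3 : MvPolynomial (Fin 4) k) =
      monomial (Finsupp.single i 1 + Finsupp.single 2 1 + Finsupp.single 3 1) 1 := by
    simp [X, monomial_mul]
  have hne : (Finsupp.single 0 1 + Finsupp.single 2 1 + Finsupp.single 3 1 : Fin 4 →₀ ℕ) ≠
      Finsupp.single 1 1 + Finsupp.single 2 1 + Finsupp.single 3 1 := by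
    intro h
    simpa using DFunLike.congr_fun h 0
  apply hd
  rw [hmon, hmon, coeff_sub, coeff_add, coeff_C_mul, coeff_C_mul, coeff_monomial,
    coeff_monomial]
  by_cases h0 : Finsupp.single 0 1 + Finsupp.single 2 1 + Finsupp.single 3 1 = d
  · subst h0
    simp [hne.symm]
  by_cases h1 : Finsupp.single 1 1 + Finsupp.single 2 1 + Finsupp.single 3 1 = d
  · subst h1
    simp [hne]
  have hdg : coeff d g = 0 := by
    by_contra hc
    have hw := hg hc
    rw [Finsupp.weight_apply, Finsupp.sum_fintype _ _ (by simp), Fin.sum_univ_four] at hw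
    simp only [smul_eq_mul, Matrix.cons_val] at hw
    have b0 := hlt 0
    have b1 := hlt 1
    have b2 := hlt 2
    have b3 := hlt 3
    rcases (by omega : (d 0 = 1 ∧ d 1 = 0 ∧ d 2 = 1 ∧ d 3 = 1) ∨
      (d 0 = 0 ∧ d 1 = 1 ∧ d 2 = 1 ∧ d 3 = 1)) with ⟨e0, e1, e2, e3⟩ | ⟨e0, e1, e2, e3⟩
    · apply h0
      ext i
      fin_cases i <;> simp [e0, e1, e2, e3]
    · apply h1
      ext i
      fin_cases i <;> simp [e0, e1, e2, e3]
  simp [hdg, h0, h1]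

/-- The congruence for a sum of `w ^ 2` and sextic monomials in `x, y, z` with arbitrary
Teichmüller coefficients. -/
theorem map_mul_delta_sub_mem_span {k : Type*} [CommRing k] [IsDomain k] [CharP k 2]
    (φ : MvPolynomial (Fin 4) (WittVector 2 k) →+* MvPolynomial (Fin 4) (WittVector 2 k))
    (hφC : ∀ α : WittVector 2 k, φ (C α) = C (WittVector.frobenius α))
    (hφX : ∀ i : Fin 4, φ (X i) = X i ^ 2)
    (r : WittVector 2 k →+* k) (hr : ∀ α : WittVector 2 k, r α = α.coeff 0)
    (t1 t2 t3 t4 t5 t6 t7 t8 t9 t10 t11 t12 : k)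
    (l : List (MvPolynomial (Fin 4) (WittVector 2 k)))
    (hl : l = [X 3 ^ 2,
      C (WittVector.teichmuller 2 t1) * X 2 ^ 3,
      C (WittVector.teichmuller 2 t2) * X 1 ^ 2 * X 2 ^ 2,
      C (WittVector.teichmuller 2 t3) * X 0 * X 1 * X 2 ^ 2,
      C (WittVector.teichmuller 2 t4) * X 0 ^ 2 * X 2 ^ 2,
      C (WittVector.teichmuller 2 t5) * X 0 * X 1 ^ 3 * X 2,
      C (WittVector.teichmuller 2 t6) * X 0 ^ 2 * X 1 ^ 2 * X 2,
      C (WittVector.teichmuller 2 t7) * X 0 ^ 3 * X 1 * X 2,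
      C (WittVector.teichmuller 2 t8) * X 0 ^ 4 * X 2,
      C (WittVector.teichmuller 2 t9) * X 1 ^ 6,
      C (WittVector.teichmuller 2 t10) * X 0 ^ 2 * X 1 ^ 4,
      C (WittVector.teichmuller 2 t11) * X 0 ^ 4 * X 1 ^ 2,
      C (WittVector.teichmuller 2 t12) * X 0 ^ 6])
    (G D : MvPolynomial (Fin 4) (WittVector 2 k))
    (hG : IsWeightedHomogeneous (![1, 1, 2, 3] : Fin 4 → ℕ) G 6)
    (hD : 2 * D = φ (l.sum + 2 * G) - (l.sum + 2 * G) ^ 2) :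
    MvPolynomial.map r (l.sum * D) -
        C (t2 * t7 + t3 * t6 + t4 * t5
            + coeff (Finsupp.single 0 1 + Finsupp.single 2 1 + Finsupp.single 3 1)
                (MvPolynomial.map r G) ^ 2 * t5
            + coeff (Finsupp.single 1 1 + Finsupp.single 2 1 + Finsupp.single 3 1)
                (MvPolynomial.map r G) ^ 2 * t7)
          * (X 0 ^ 3 * X 1 ^ 3 * X 2 ^ 3 * X 3 ^ 2)
      ∈ Ideal.span ({X 0 ^ 4, X 1 ^ 4, X 2 ^ 4, X 3 ^ 4} : Set (MvPolynomial (Fin 4) k)) := by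
  have h2W : (2 : MvPolynomial (Fin 4) (WittVector 2 k)) ≠ 0 := by
    have h : ((2 : ℕ) : WittVector 2 k) ≠ 0 := WittVector.p_nonzero 2 k
    rw [← map_ofNat C 2]
    exact (map_ne_zero_iff _ (C_injective _ _)).2 (by exact_mod_cast h)
  have h2 : (2 : MvPolynomial (Fin 4) k) = 0 := CharTwo.two_eq_zero
  have hφT (α : k) : φ (C (WittVector.teichmuller 2 α)) =
      C (WittVector.teichmuller 2 α) ^ 2 := by
    rw [hφC, frobenius_teichmuller, C_pow]
  have hrT (α : k) : r (WittVector.teichmuller 2 α) = α := by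
    rw [hr, WittVector.teichmuller_coeff_zero]
  have hlφ : ∀ m ∈ l, φ m = m ^ 2 := by
    simp [hl, hφX, hφT, mul_pow, ← pow_mul]
  have hGr : IsWeightedHomogeneous (![1, 1, 2, 3] : Fin 4 → ℕ) (MvPolynomial.map r G) 6 := by
    intro d hd
    refine hG fun h0 => hd ?_
    rw [coeff_map, h0, map_zero]
  have hsq := sq_mem_span_fourth_powers _ (sub_mem_span_squares _ hGr)
  rw [eq_of_two_mul_eq_map_sub_sq h2W φ l hlφ G D hD, map_mul, map_sub, map_sub,
    map_frobeniusLift φ hφC hφX r hr, map_mul _ 2, map_ofNat, h2, zero_mul, sub_zero,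
    map_list_sum, map_pairSum]
  generalize MvPolynomial.map r G = g at *
  generalize coeff (Finsupp.single 0 1 + Finsupp.single 2 1 + Finsupp.single 3 1) g = p at *
  generalize coeff (Finsupp.single 1 1 + Finsupp.single 2 1 + Finsupp.single 3 1) g = q at *
  generalize hI : Ideal.span
    ({X 0 ^ 4, X 1 ^ 4, X 2 ^ 4, X 3 ^ 4} : Set (MvPolynomial (Fin 4) k)) = I at *
  have hX (i : Fin 4) : Ideal.Quotient.mk I (X i) ^ 4 = 0 := by
    rw [← map_pow, Ideal.Quotient.eq_zero_iff_mem, ← hI]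
    apply Ideal.subset_span
    fin_cases i <;> simp
  rw [← Ideal.Quotient.eq_zero_iff_mem] at hsq ⊢
  rw [map_pow] at hsq
  have key := mul_pairSum_add_sq_eq (by rw [← map_ofNat (Ideal.Quotient.mk I), h2, map_zero])
    _ _ _ _ (hX 0) (hX 1) (hX 2) (hX 3)
    (Ideal.Quotient.mk I (C t1)) (Ideal.Quotient.mk I (C t2)) (Ideal.Quotient.mk I (C t3))
    (Ideal.Quotient.mk I (C t4)) (Ideal.Quotient.mk I (C t5)) (Ideal.Quotient.mk I (C t6))
    (Ideal.Quotient.mk I (C t7)) (Ideal.Quotient.mk I (C t8)) (Ideal.Quotient.mk I (C t9))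
    (Ideal.Quotient.mk I (C t10)) (Ideal.Quotient.mk I (C t11)) (Ideal.Quotient.mk I (C t12))
    (Ideal.Quotient.mk I (C p)) (Ideal.Quotient.mk I (C q)) _ hsq
    ((l.map (MvPolynomial.map r)).map (Ideal.Quotient.mk I)) (by simp [hl, hrT])
  rw [map_sub, map_mul, map_sub, map_list_sum, map_pairSum, map_pow, sub_eq_zero]
  convert key using 1
  · congr 3
    simp only [map_sub, map_add, map_mul]
    ring
  · simp only [map_add, map_mul, map_pow]

/-- 8A₁ del Pezzo, key congruence.
`k` is an algebraically closed field of characteristic 2, `S = W(k)[x,y,z,w]` with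
`deg x = deg y = 1`, `deg z = 2`, `deg w = 3`, `φ` acts on coefficients by the Witt vector
Frobenius and squares the variables, `ρ` reduces coefficients via the 0-th Witt coordinate,
`[·]` is the Teichmüller lift, and `f` is the 8A₁ equation below.
For every homogeneous `G` of degree 6 and every `D` with `2D = φ(f+2G) − (f+2G)²`,
`ρ(f·D) ≡ s₁²(s₁s₂+s₃)(s₁⁴+g₁²+g₂²)·x³y³z³w²  mod (x⁴,y⁴,z⁴,w⁴)`,
where `g₁, g₂` are the coefficients of `xzw`, `yzw` in `ρ(G)`. -/
theorem stmt5 (k : Type*) [Field k] [IsAlgClosed k] [CharP k 2]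
    (φ : MvPolynomial (Fin 4) (WittVector 2 k) →+* MvPolynomial (Fin 4) (WittVector 2 k))
    (hφC : ∀ α : WittVector 2 k, φ (C α) = C (WittVector.frobenius α))
    (hφX : ∀ i : Fin 4, φ (X i) = X i ^ 2)
    (r : WittVector 2 k →+* k)
    (hr : ∀ α : WittVector 2 k, r α = α.coeff 0)
    (a b c : k) (habc : a * b * c * (a + b) * (b + c) * (c + a) * (a + b + c) ≠ 0)
    (s₁ s₂ s₃ : k) (hs₁ : s₁ = a + b + c) (hs₂ : s₂ = a * b + b * c + c * a)
    (hs₃ : s₃ = a * b * c)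
    (f : MvPolynomial (Fin 4) (WittVector 2 k))
    (hf : f = X 3 ^ 2
      + C (WittVector.teichmuller 2 (a * b * c)) * X 2 ^ 3
      + C (WittVector.teichmuller 2 ((a * b + b * c + c * a) ^ 2 + a * b * c * (a + b + c)))
          * X 1 ^ 2 * X 2 ^ 2
      + C (WittVector.teichmuller 2 ((a + b + c) * (a + b) * (b + c) * (c + a)))
          * X 0 * X 1 * X 2 ^ 2
      + C (WittVector.teichmuller 2 ((a * b + b * c + c * a) ^ 2)) * X 0 ^ 2 * X 2 ^ 2
      + C (WittVector.teichmuller 2 ((a + b + c) ^ 2 * (a + b) * (b + c) * (c + a)))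
          * X 0 * X 1 ^ 3 * X 2
      + C (WittVector.teichmuller 2 ((a + b + c) ^ 2 * ((a + b + c) ^ 3 + a * b * c)))
          * X 0 ^ 2 * X 1 ^ 2 * X 2
      + C (WittVector.teichmuller 2 ((a + b + c) ^ 2 * (a + b) * (b + c) * (c + a)))
          * X 0 ^ 3 * X 1 * X 2
      + C (WittVector.teichmuller 2 ((a + b + c) ^ 2 * (a * b * c))) * X 0 ^ 4 * X 2
      + C (WittVector.teichmuller 2 ((a + b) ^ 2 * (b + c) ^ 2 * (c + a) ^ 2)) * X 1 ^ 6
      + C (WittVector.teichmuller 2 (((a + b + c) ^ 3 + a * b * c) ^ 2)) * X 0 ^ 2 * X 1 ^ 4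
      + C (WittVector.teichmuller 2 ((a + b) ^ 2 * (b + c) ^ 2 * (c + a) ^ 2))
          * X 0 ^ 4 * X 1 ^ 2
      + C (WittVector.teichmuller 2 (a ^ 2 * b ^ 2 * c ^ 2)) * X 0 ^ 6)
    (G : MvPolynomial (Fin 4) (WittVector 2 k))
    (hG : MvPolynomial.IsWeightedHomogeneous (![1, 1, 2, 3] : Fin 4 → ℕ) G 6)
    (D : MvPolynomial (Fin 4) (WittVector 2 k))
    (hD : 2 * D = φ (f + 2 * G) - (f + 2 * G) ^ 2) :
    MvPolynomial.map r (f * D) -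
        C (s₁ ^ 2 * (s₁ * s₂ + s₃) * (s₁ ^ 4
            + (MvPolynomial.coeff
                (Finsupp.single 0 1 + Finsupp.single 2 1 + Finsupp.single 3 1)
                (MvPolynomial.map r G)) ^ 2
            + (MvPolynomial.coeff
                (Finsupp.single 1 1 + Finsupp.single 2 1 + Finsupp.single 3 1)
                (MvPolynomial.map r G)) ^ 2))
          * (X 0 ^ 3 * X 1 ^ 3 * X 2 ^ 3 * X 3 ^ 2)
      ∈ Ideal.span ({X 0 ^ 4, X 1 ^ 4, X 2 ^ 4, X 3 ^ 4} : Set (MvPolynomial (Fin 4) k)) := by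
  obtain ⟨l, hl⟩ : ∃ l : List (MvPolynomial (Fin 4) (WittVector 2 k)), l = [X 3 ^ 2,
      C (WittVector.teichmuller 2 (a * b * c)) * X 2 ^ 3,
      C (WittVector.teichmuller 2 ((a * b + b * c + c * a) ^ 2 + a * b * c * (a + b + c)))
          * X 1 ^ 2 * X 2 ^ 2,
      C (WittVector.teichmuller 2 ((a + b + c) * (a + b) * (b + c) * (c + a)))
          * X 0 * X 1 * X 2 ^ 2,
      C (WittVector.teichmuller 2 ((a * b + b * c + c * a) ^ 2)) * X 0 ^ 2 * X 2 ^ 2,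
      C (WittVector.teichmuller 2 ((a + b + c) ^ 2 * (a + b) * (b + c) * (c + a)))
          * X 0 * X 1 ^ 3 * X 2,
      C (WittVector.teichmuller 2 ((a + b + c) ^ 2 * ((a + b + c) ^ 3 + a * b * c)))
          * X 0 ^ 2 * X 1 ^ 2 * X 2,
      C (WittVector.teichmuller 2 ((a + b + c) ^ 2 * (a + b) * (b + c) * (c + a)))
          * X 0 ^ 3 * X 1 * X 2,
      C (WittVector.teichmuller 2 ((a + b + c) ^ 2 * (a * b * c))) * X 0 ^ 4 * X 2,
      C (WittVector.teichmuller 2 ((a + b) ^ 2 * (b + c) ^ 2 * (c + a) ^ 2)) * X 1 ^ 6,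
      C (WittVector.teichmuller 2 (((a + b + c) ^ 3 + a * b * c) ^ 2)) * X 0 ^ 2 * X 1 ^ 4,
      C (WittVector.teichmuller 2 ((a + b) ^ 2 * (b + c) ^ 2 * (c + a) ^ 2))
          * X 0 ^ 4 * X 1 ^ 2,
      C (WittVector.teichmuller 2 (a ^ 2 * b ^ 2 * c ^ 2)) * X 0 ^ 6] := ⟨_, rfl⟩
  have hfl : f = l.sum := by
    rw [hf, hl]
    simp only [List.sum_cons, List.sum_nil, add_zero, add_assoc]
  rw [hfl] at hD ⊢
  have key := map_mul_delta_sub_mem_span φ hφC hφX r hr _ _ _ _ _ _ _ _ _ _ _ _ l hl G D hG hD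
  have h2 : (2 : k) = 0 := CharTwo.two_eq_zero
  generalize coeff (Finsupp.single 0 1 + Finsupp.single 2 1 + Finsupp.single 3 1)
    (MvPolynomial.map r G) = p at *
  generalize coeff (Finsupp.single 1 1 + Finsupp.single 2 1 + Finsupp.single 3 1)
    (MvPolynomial.map r G) = q at *
  convert key using 4
  rw [hs₁, hs₂, hs₃]
  linear_combination ((a + b + c) ^ 2 * (a * b * c) * ((a + b + c) ^ 4 + p ^ 2 + q ^ 2)
    - (a + b + c) ^ 2 * ((a + b) * (b + c) * (c + a))
      * ((a * b + b * c + c * a) ^ 2 + (a + b + c) * (a * b * c))) * h2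
end

section
/- For every homogeneous element G ∈ S of degree 6 and every D ∈ S with 2D = φ(f+2G) − (f+2G)², it is not the case that both ρ(f·D) ∈ m^[4] = (x⁴, y⁴, z⁴, w⁴) and ρ(f·D³) ∈ m^[8] = (x⁸, y⁸, z⁸, w⁸). (This is the computational content of the statement that W(k)[x,y,z,w]/(f+2G) is 3-quasi-F-split for every homogeneous G of degree 6.) -/
open MvPolynomial

/-- The exponent vector of a monomial, given by its list of exponents. -/
noncomputable abbrev expVec {σ : Type*} [Finite σ] (v : σ → ℕ) : σ →₀ ℕ :=
  Finsupp.equivFunOnFinite.symm v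

section Auxiliary

variable {σ ι k : Type*}

lemma expVec_coe [Finite σ] (m : σ →₀ ℕ) : expVec (⇑m) = m :=
  Finsupp.equivFunOnFinite.symm_apply_apply m

lemma sum_sq_eq_sum_sq_add_two_mul {R : Type*} [CommRing R] [Fintype ι] [LinearOrder ι]
    (m : ι → R) :
    (∑ i, m i) ^ 2 = ∑ i, m i ^ 2 + 2 * ∑ p : ι × ι with p.1 < p.2, m p.1 * m p.2 := by
  have hlt : ∑ i, ∑ j, (if j < i then m i * m j else 0) =
      ∑ i, ∑ j, (if i < j then m i * m j else 0) := by
    rw [Finset.sum_comm]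
    simp only [mul_comm]
  have hsplit : ∀ i j, m i * m j = (if i = j then m i * m j else 0) +
      ((if i < j then m i * m j else 0) + (if j < i then m i * m j else 0)) := by
    intro i j
    rcases lt_trichotomy i j with h | h | h
    · simp [h, h.ne, h.not_gt]
    · simp [h]
    · simp [h, h.ne', h.not_gt]
  rw [Finset.sum_filter, Fintype.sum_prod_type, two_mul]
  nth_rewrite 2 [← hlt]
  rw [sq, Finset.sum_mul_sum, ← Finset.sum_add_distrib, ← Finset.sum_add_distrib]
  refine Finset.sum_congr rfl fun i _ => ?_
  rw [Finset.sum_congr rfl fun j _ => hsplit i j, Finset.sum_add_distrib, Finset.sum_add_distrib]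
  simp [sq]

/-- In `k[x₁, …, xₙ]` over a ring of characteristic two, the coefficients of `p² q` are
semilinear in `p`. -/
lemma coeff_sq_mul [Fintype σ] [DecidableEq σ] [CommRing k] [CharP k 2]
    (p q : MvPolynomial σ k) (n : σ → ℕ) :
    coeff (expVec n) (p ^ 2 * q) = ∑ m ∈ Finset.Iic fun i => n i / 2,
      coeff (expVec m) p ^ 2 * coeff (expVec fun i => n i - 2 * m i) q := by
  induction p using MvPolynomial.induction_on' with
  | monomial s c =>
    obtain ⟨v, rfl⟩ : ∃ v, s = expVec v := ⟨s, (expVec_coe s).symm⟩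
    have h2 : (2 • expVec v ≤ expVec n) ↔ v ∈ Finset.Iic fun i => n i / 2 := by
      rw [Finset.mem_Iic, Pi.le_def, Finsupp.le_def]
      refine forall_congr' fun i => ?_
      simp only [Finsupp.smul_apply, Finsupp.equivFunOnFinite_symm_apply_apply, smul_eq_mul]
      lia
    have h3 : expVec n - 2 • expVec v = expVec fun i => n i - 2 * v i := by
      ext i; simp
    rw [monomial_pow, coeff_monomial_mul', h3]
    simp only [coeff_monomial, h2, EmbeddingLike.apply_eq_iff_eq, ite_pow, ite_mul]
    simp
  | add p₁ p₂ h₁ h₂ =>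
    rw [CharTwo.add_sq, add_mul, coeff_add, h₁, h₂, ← Finset.sum_add_distrib]
    refine Finset.sum_congr rfl fun m _ => ?_
    rw [coeff_add, CharTwo.add_sq]
    ring

lemma coeff_sq [Fintype σ] [DecidableEq σ] [CommRing k] [CharP k 2]
    (p : MvPolynomial σ k) (n : σ → ℕ) :
    coeff (expVec n) (p ^ 2) =
      if ∀ i, Even (n i) then coeff (expVec fun i => n i / 2) p ^ 2 else 0 := by
  have key : ∀ m ∈ Finset.Iic fun i => n i / 2,
      coeff (expVec m) p ^ 2 * coeff (expVec fun i => n i - 2 * m i) (1 : MvPolynomial σ k) =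
        if (∀ i, Even (n i)) ∧ m = fun i => n i / 2
          then coeff (expVec fun i => n i / 2) p ^ 2 else 0 := by
    intro m hm
    have h : (0 = expVec fun i => n i - 2 * m i) ↔
        (∀ i, Even (n i)) ∧ m = fun i => n i / 2 := by
      rw [Finset.mem_Iic, Pi.le_def] at hm
      rw [funext_iff, Finsupp.ext_iff, ← forall_and]
      refine forall_congr' fun i => ?_
      have := hm i
      simp only [Finsupp.coe_zero, Pi.zero_apply, Finsupp.equivFunOnFinite_symm_apply_apply,
        Nat.even_iff]
      lia
    rw [coeff_one]
    simp only [h]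
    split_ifs with h'
    · rw [h'.2, mul_one]
    · rw [mul_zero]
  rw [← mul_one (p ^ 2), coeff_sq_mul, Finset.sum_congr rfl key]
  split_ifs with h
  · simp [h]
  · simp [h]

lemma coeff_eq_zero_of_mem_span_X_pow [CommRing k] {N : ℕ} {p : MvPolynomial (Fin 4) k}
    (hp : p ∈ Ideal.span ({X 0 ^ N, X 1 ^ N, X 2 ^ N, X 3 ^ N} : Set (MvPolynomial (Fin 4) k)))
    {m : Fin 4 → ℕ} (hm : ∀ i, m i < N) : coeff (expVec m) p = 0 := by
  have h : ∀ (i : Fin 4) (q : MvPolynomial (Fin 4) k), coeff (expVec m) (q * X i ^ N) = 0 := by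
    intro i q
    rw [X_pow_eq_monomial, coeff_mul_monomial', if_neg]
    intro hle
    have := hle i
    simp only [Finsupp.single_eq_same, Finsupp.equivFunOnFinite_symm_apply_apply] at this
    exact absurd (hm i) this.not_gt
  simp only [Ideal.mem_span_insert, Ideal.mem_span_singleton'] at hp
  obtain ⟨a₀, _, ⟨a₁, _, ⟨a₂, _, ⟨a₃, rfl⟩, rfl⟩, rfl⟩, rfl⟩ := hp
  simp only [coeff_add, h, add_zero]

section Witt

variable [Field k] [CharP k 2]
  {φ : MvPolynomial σ (WittVector 2 k) →+* MvPolynomial σ (WittVector 2 k)}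

lemma lift_monomial_teichmuller
    (hφC : ∀ α : WittVector 2 k, φ (C α) = C (WittVector.frobenius α))
    (hφX : ∀ i : σ, φ (X i) = X i ^ 2) (s : σ →₀ ℕ) (c : k) :
    φ (monomial s (WittVector.teichmuller 2 c)) =
      monomial s (WittVector.teichmuller 2 c) ^ 2 := by
  have hc : WittVector.frobenius (WittVector.teichmuller 2 c) =
      WittVector.teichmuller 2 c ^ 2 := by
    rw [WittVector.frobenius_eq_map_frobenius, WittVector.map_teichmuller, frobenius_def, map_pow]
  rw [monomial_eq, map_mul, hφC, hc, mul_pow, C_pow, map_finsuppProd, Finsupp.prod,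
    Finsupp.prod, ← Finset.prod_pow]
  congr 1
  refine Finset.prod_congr rfl fun i _ => ?_
  rw [map_pow, hφX, pow_right_comm]

lemma map_lift_eq_sq
    (hφC : ∀ α : WittVector 2 k, φ (C α) = C (WittVector.frobenius α))
    (hφX : ∀ i : σ, φ (X i) = X i ^ 2)
    {r : WittVector 2 k →+* k} (hr : ∀ α : WittVector 2 k, r α = α.coeff 0)
    (G : MvPolynomial σ (WittVector 2 k)) : map r (φ G) = map r G ^ 2 := by
  have h : (map r).comp φ = (frobenius (MvPolynomial σ k) 2).comp (map r) := by
    refine MvPolynomial.ringHom_ext (fun α => ?_) fun i => ?_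
    · simp [hφC, hr, frobenius_def, WittVector.coeff_frobenius_charP]
    · simp [hφX, frobenius_def]
  exact congrArg (fun g => g G) h

/-- The reduction of the delta invariant of a lift of `∑ cᵢ x^{sᵢ}`. -/
lemma map_delta_eq [Fintype ι] [LinearOrder ι]
    (hφC : ∀ α : WittVector 2 k, φ (C α) = C (WittVector.frobenius α))
    (hφX : ∀ i : σ, φ (X i) = X i ^ 2)
    {r : WittVector 2 k →+* k} (hr : ∀ α : WittVector 2 k, r α = α.coeff 0)
    (s : ι → σ →₀ ℕ) (c : ι → k) {f G D : MvPolynomial σ (WittVector 2 k)}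
    (hf : f = ∑ i, monomial (s i) (WittVector.teichmuller 2 (c i)))
    (hD : 2 * D = φ (f + 2 * G) - (f + 2 * G) ^ 2) :
    map r D = ∑ p : ι × ι with p.1 < p.2, monomial (s p.1 + s p.2) (c p.1 * c p.2) +
      map r G ^ 2 := by
  have hφf : φ f = ∑ i, monomial (s i) (WittVector.teichmuller 2 (c i)) ^ 2 := by
    rw [hf, map_sum]
    exact Finset.sum_congr rfl fun i _ => lift_monomial_teichmuller hφC hφX _ _
  have hsq := sum_sq_eq_sum_sq_add_two_mul
    fun i => monomial (s i) (WittVector.teichmuller 2 (c i))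
  rw [← hφf, ← hf] at hsq
  set E := ∑ p : ι × ι with p.1 < p.2, monomial (s p.1) (WittVector.teichmuller 2 (c p.1)) *
    monomial (s p.2) (WittVector.teichmuller 2 (c p.2)) with hE
  have h2 : (2 : MvPolynomial σ (WittVector 2 k)) ≠ 0 := by
    rw [← map_ofNat C 2, Ne, C_eq_zero]
    exact_mod_cast WittVector.p_nonzero 2 k
  have hD' : D = -E + φ G - 2 * (f * G + G ^ 2) := by
    refine mul_left_cancel₀ h2 ?_
    rw [hD, map_add, map_mul, map_ofNat]
    linear_combination -hsq
  have h2' : (2 : MvPolynomial σ k) = 0 := CharTwo.two_eq_zero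
  rw [hD', map_sub, map_add, map_neg, map_lift_eq_sq hφC hφX hr, map_mul, map_ofNat, h2',
    zero_mul, sub_zero, CharTwo.neg_eq, hE, map_sum]
  simp only [monomial_mul, map_monomial, ← map_mul (WittVector.teichmuller 2), hr,
    WittVector.teichmuller_coeff_zero]

end Witt

end Auxiliary

section DelPezzo

/-- The exponents of the monomials of the equation of the `8A₁` del Pezzo surface. -/
def delPezzoExp : Fin 13 → Fin 4 → ℕ :=
  ![![0, 0, 0, 2], ![0, 0, 3, 0], ![0, 2, 2, 0], ![1, 1, 2, 0],
    ![2, 0, 2, 0], ![1, 3, 1, 0], ![2, 2, 1, 0], ![3, 1, 1, 0],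
    ![4, 0, 1, 0], ![0, 6, 0, 0], ![2, 4, 0, 0], ![4, 2, 0, 0],
    ![6, 0, 0, 0]]

variable {k : Type*} [Field k]

/-- The coefficients of the equation of the `8A₁` del Pezzo surface, where `s₁`, `s₂`, `s₃` are the
elementary symmetric functions of `a, b, c` and `q = (a + b) (b + c) (c + a)`. -/
def delPezzoCoeff (s₁ s₂ s₃ q : k) : Fin 13 → k :=
  ![1, s₃, s₂ ^ 2 + s₃ * s₁, s₁ * q, s₂ ^ 2, s₁ ^ 2 * q, s₁ ^ 2 * (s₁ ^ 3 + s₃), s₁ ^ 2 * q,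
    s₁ ^ 2 * s₃, q ^ 2, (s₁ ^ 3 + s₃) ^ 2, q ^ 2, s₃ ^ 2]

/-- The delta invariant of `∑ cᵢ x^{eᵢ} + 2 G`, with `e` the exponents of the del Pezzo equation and
`g` the reduction of `G`. -/
noncomputable def delPezzoDelta (c : Fin 13 → k) (g : MvPolynomial (Fin 4) k) :
    MvPolynomial (Fin 4) k :=
  ∑ p : Fin 13 × Fin 13 with p.1 < p.2,
    monomial (expVec (delPezzoExp p.1) + expVec (delPezzoExp p.2)) (c p.1 * c p.2) + g ^ 2

lemma coeff_delPezzo_mul (c : Fin 13 → k) (q : MvPolynomial (Fin 4) k) (n : Fin 4 → ℕ) :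
    coeff (expVec n) ((∑ i, monomial (expVec (delPezzoExp i)) (c i)) * q) =
      ∑ i with ∀ j, delPezzoExp i j ≤ n j, c i * coeff (expVec (n - delPezzoExp i)) q := by
  rw [Finset.sum_mul, coeff_sum, Finset.sum_filter]
  refine Finset.sum_congr rfl fun i _ => ?_
  have h : expVec (delPezzoExp i) ≤ expVec n ↔ ∀ j, delPezzoExp i j ≤ n j := Iff.rfl
  have h' : expVec n - expVec (delPezzoExp i) = expVec (n - delPezzoExp i) := by ext; simp
  rw [coeff_monomial_mul', h']
  simp only [h]

variable [CharP k 2]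

lemma coeff_delPezzoDelta (c : Fin 13 → k) (g : MvPolynomial (Fin 4) k) (n : Fin 4 → ℕ) :
    coeff (expVec n) (delPezzoDelta c g) =
      ∑ p : Fin 13 × Fin 13 with p.1 < p.2 ∧ delPezzoExp p.1 + delPezzoExp p.2 = n,
        c p.1 * c p.2 +
      if ∀ i, Even (n i) then coeff (expVec fun i => n i / 2) g ^ 2 else 0 := by
  rw [delPezzoDelta, coeff_add, coeff_sq, coeff_sum, ← Finset.filter_filter]
  rw [Finset.sum_filter (fun p : Fin 13 × Fin 13 => delPezzoExp p.1 + delPezzoExp p.2 = n)]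
  congr 1
  swap
  · congr
  refine Finset.sum_congr rfl fun p _ => ?_
  have h : expVec (delPezzoExp p.1) + expVec (delPezzoExp p.2) =
      expVec (delPezzoExp p.1 + delPezzoExp p.2) := by ext; simp
  rw [h, coeff_monomial]
  simp only [EmbeddingLike.apply_eq_iff_eq]

lemma coeff_delPezzoDelta_eq_zero (c : Fin 13 → k) {g : MvPolynomial (Fin 4) k}
    (hg : ∀ m : Fin 4 → ℕ, m 0 + m 1 + 2 * m 2 + 3 * m 3 ≠ 6 → coeff (expVec m) g = 0)
    {n : Fin 4 → ℕ} (hn : ¬(n 0 + n 1 + 2 * n 2 + 3 * n 3 = 12 ∧ Even (n 3))) :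
    coeff (expVec n) (delPezzoDelta c g) = 0 := by
  have hw : ∀ i, delPezzoExp i 0 + delPezzoExp i 1 + 2 * delPezzoExp i 2 + 3 * delPezzoExp i 3 = 6 ∧
      Even (delPezzoExp i 3) := by decide
  rw [coeff_delPezzoDelta, Finset.sum_eq_zero, zero_add]
  · split_ifs with h
    · rw [hg, zero_pow two_ne_zero]
      have h0 := h 0
      have h1 := h 1
      have h2 := h 2
      have h3 := h 3
      rw [Nat.even_iff] at h0 h1 h2 h3 hn
      lia
    · rfl
  · rintro p hp
    refine absurd ?_ hn
    rw [← (Finset.mem_filter.1 hp).2.2]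
    have h1 := hw p.1
    have h2 := hw p.2
    simp only [Pi.add_apply]
    exact ⟨by lia, h1.2.add h2.2⟩

lemma coeff_delPezzo_mul_delPezzoDelta_cube (c : Fin 13 → k) {g : MvPolynomial (Fin 4) k}
    (hg : ∀ m : Fin 4 → ℕ, m 0 + m 1 + 2 * m 2 + 3 * m 3 ≠ 6 → coeff (expVec m) g = 0)
    (n : Fin 4 → ℕ) :
    coeff (expVec n) ((∑ i, monomial (expVec (delPezzoExp i)) (c i)) * delPezzoDelta c g ^ 3) =
      ∑ m ∈ Finset.Iic fun i => n i / 2 with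
          m 0 + m 1 + 2 * m 2 + 3 * m 3 = 12 ∧ Even (m 3),
        coeff (expVec m) (delPezzoDelta c g) ^ 2 * coeff (expVec (n - (m + m)))
          ((∑ i, monomial (expVec (delPezzoExp i)) (c i)) * delPezzoDelta c g) := by
  have h : ∀ F D : MvPolynomial (Fin 4) k, F * D ^ 3 = D ^ 2 * (F * D) := fun F D => by ring
  have h' : ∀ m : Fin 4 → ℕ, (fun i => n i - 2 * m i) = n - (m + m) := fun m =>
    funext fun i => by simp [two_mul]
  simp only [h, coeff_sq_mul, h']
  rw [Finset.sum_filter_of_ne]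
  intro m _ hm
  by_contra hcon
  exact hm (by rw [coeff_delPezzoDelta_eq_zero c hg hcon, zero_pow two_ne_zero, zero_mul])

lemma coeff_delPezzoDelta_of_odd (c : Fin 13 → k) (g : MvPolynomial (Fin 4) k) {n : Fin 4 → ℕ}
    {t : Finset (Fin 13 × Fin 13)}
    (ht : (Finset.univ.filter fun p : Fin 13 × Fin 13 =>
      p.1 < p.2 ∧ delPezzoExp p.1 + delPezzoExp p.2 = n) = t)
    (hn : ¬∀ i, Even (n i)) :
    coeff (expVec n) (delPezzoDelta c g) = ∑ p ∈ t, c p.1 * c p.2 := by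
  rw [coeff_delPezzoDelta, ht, if_neg hn, add_zero]

/-- For the del Pezzo equation `F` and any admissible delta invariant `D`, the polynomials `F D` and
`F D³` cannot both be combinations of monomials with an exponent at least `4`, respectively `8`. -/
lemma not_forall_coeff_delPezzo_eq_zero {s₁ s₂ s₃ q : k} (h₁ : s₁ ≠ 0) (h₃ : s₃ ≠ 0) (hq : q ≠ 0)
    {g : MvPolynomial (Fin 4) k}
    (hg : ∀ m : Fin 4 → ℕ, m 0 + m 1 + 2 * m 2 + 3 * m 3 ≠ 6 → coeff (expVec m) g = 0)
    {c : Fin 13 → k} (hc : c = delPezzoCoeff s₁ s₂ s₃ q)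
    {F D : MvPolynomial (Fin 4) k}
    (hF : F = ∑ i, monomial (expVec (delPezzoExp i)) (c i))
    (hD : D = delPezzoDelta c g)
    (hFD : ∀ n : Fin 4 → ℕ, (∀ i, n i < 4) → coeff (expVec n) (F * D) = 0)
    (hFD3 : ∀ n : Fin 4 → ℕ, (∀ i, n i < 8) → coeff (expVec n) (F * D ^ 3) = 0) : False := by
  have h2 : (2 : k) = 0 := CharTwo.two_eq_zero
  have c0 : c 0 = 1 := by rw [hc]; rfl
  have d0032 : coeff (expVec ![0, 0, 3, 2]) D = c 0 * c 1 := by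
    rw [hD, coeff_delPezzoDelta_of_odd c g (t := {(0, 1)}) (by decide +kernel) (by decide)]
    simp
  have d0412 : coeff (expVec ![0, 4, 1, 2]) D = 0 := by
    rw [hD, coeff_delPezzoDelta_of_odd c g (t := ∅) (by decide +kernel) (by decide)]
    simp
  have d1122 : coeff (expVec ![1, 1, 2, 2]) D = c 0 * c 3 := by
    rw [hD, coeff_delPezzoDelta_of_odd c g (t := {(0, 3)}) (by decide +kernel) (by decide)]
    simp
  have d1150 : coeff (expVec ![1, 1, 5, 0]) D = c 1 * c 3 := by
    rw [hD, coeff_delPezzoDelta_of_odd c g (t := {(1, 3)}) (by decide +kernel) (by decide)]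
    simp
  have d1312 : coeff (expVec ![1, 3, 1, 2]) D = c 0 * c 5 := by
    rw [hD, coeff_delPezzoDelta_of_odd c g (t := {(0, 5)}) (by decide +kernel) (by decide)]
    simp
  have d1502 : coeff (expVec ![1, 5, 0, 2]) D = 0 := by
    rw [hD, coeff_delPezzoDelta_of_odd c g (t := ∅) (by decide +kernel) (by decide)]
    simp
  have d1530 : coeff (expVec ![1, 5, 3, 0]) D = c 2 * c 5 := by
    rw [hD, coeff_delPezzoDelta_of_odd c g (t := {(2, 5)}) (by decide +kernel) (by decide)]
    simp
  have d2212 : coeff (expVec ![2, 2, 1, 2]) D = c 0 * c 6 := by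
    rw [hD, coeff_delPezzoDelta_of_odd c g (t := {(0, 6)}) (by decide +kernel) (by decide)]
    simp
  have d3112 : coeff (expVec ![3, 1, 1, 2]) D = c 0 * c 7 := by
    rw [hD, coeff_delPezzoDelta_of_odd c g (t := {(0, 7)}) (by decide +kernel) (by decide)]
    simp
  have d3302 : coeff (expVec ![3, 3, 0, 2]) D = 0 := by
    rw [hD, coeff_delPezzoDelta_of_odd c g (t := ∅) (by decide +kernel) (by decide)]
    simp
  have d3330 : coeff (expVec ![3, 3, 3, 0]) D = c 2 * c 7 + c 3 * c 6 + c 4 * c 5 := by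
    rw [hD, coeff_delPezzoDelta_of_odd c g (t := {(2, 7), (3, 6), (4, 5)})
      (by decide +kernel) (by decide)]
    simp [add_assoc]
  have d3710 : coeff (expVec ![3, 7, 1, 0]) D = c 5 * c 10 + c 7 * c 9 := by
    rw [hD, coeff_delPezzoDelta_of_odd c g (t := {(5, 10), (7, 9)}) (by decide +kernel) (by decide)]
    simp
  have d4012 : coeff (expVec ![4, 0, 1, 2]) D = c 0 * c 8 := by
    rw [hD, coeff_delPezzoDelta_of_odd c g (t := {(0, 8)}) (by decide +kernel) (by decide)]
    simp
  have d5102 : coeff (expVec ![5, 1, 0, 2]) D = 0 := by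
    rw [hD, coeff_delPezzoDelta_of_odd c g (t := ∅) (by decide +kernel) (by decide)]
    simp
  have d5130 : coeff (expVec ![5, 1, 3, 0]) D = c 3 * c 8 + c 4 * c 7 := by
    rw [hD, coeff_delPezzoDelta_of_odd c g (t := {(3, 8), (4, 7)}) (by decide +kernel) (by decide)]
    simp
  have d5510 : coeff (expVec ![5, 5, 1, 0]) D = c 5 * c 11 + c 7 * c 10 := by
    rw [hD, coeff_delPezzoDelta_of_odd c g (t := {(5, 11), (7, 10)})
      (by decide +kernel) (by decide)]
    simp
  have d7310 : coeff (expVec ![7, 3, 1, 0]) D = c 5 * c 12 + c 7 * c 11 := by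
    rw [hD, coeff_delPezzoDelta_of_odd c g (t := {(5, 12), (7, 11)})
      (by decide +kernel) (by decide)]
    simp
  set B := coeff (expVec ![0, 2, 2, 2]) D with hB
  set A := coeff (expVec ![2, 0, 2, 2]) D with hA
  set V₄ := coeff (expVec ![0, 6, 0, 2]) D with hV₄
  set V₃ := coeff (expVec ![2, 4, 0, 2]) D with hV₃
  set V₂ := coeff (expVec ![4, 2, 0, 2]) D with hV₂
  set V₁ := coeff (expVec ![6, 0, 0, 2]) D with hV₁
  have r115 : coeff (expVec ![1, 1, 5, 2]) (F * D) = c 1 * c 3 := by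
    rw [hF, coeff_delPezzo_mul,
      show (Finset.univ.filter fun i => ∀ j, delPezzoExp i j ≤ ![1, 1, 5, 2] j) =
      {0, 1, 3} by decide +kernel]
    simp [delPezzoExp, d1150, d1122, d0032, c0]
    linear_combination (c 1 * c 3) * h2
  have r153 : coeff (expVec ![1, 5, 3, 2]) (F * D) = c 5 * B := by
    rw [hF, coeff_delPezzo_mul,
      show (Finset.univ.filter fun i => ∀ j, delPezzoExp i j ≤ ![1, 5, 3, 2] j) =
      {0, 1, 2, 3, 5} by decide +kernel]
    simp [delPezzoExp, d1530, d1502, d1312, d0412, ← hB, c0]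
    linear_combination (c 2 * c 5) * h2
  have r333 : coeff (expVec ![3, 3, 3, 2]) (F * D) = c 3 * c 6 + c 5 * A + c 7 * B := by
    rw [hF, coeff_delPezzo_mul,
      show (Finset.univ.filter fun i => ∀ j, delPezzoExp i j ≤ ![3, 3, 3, 2] j) =
      {0, 1, 2, 3, 4, 5, 6, 7} by decide +kernel]
    simp [delPezzoExp, d3330, d3302, d3112, d2212, d1312, ← hA, d1122, ← hB, c0]
    linear_combination (c 2 * c 7 + c 3 * c 6 + c 4 * c 5) * h2
  have r371 : coeff (expVec ![3, 7, 1, 2]) (F * D) = c 5 * V₃ + c 7 * V₄ := by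
    rw [hF, coeff_delPezzo_mul,
      show (Finset.univ.filter fun i => ∀ j, delPezzoExp i j ≤ ![3, 7, 1, 2] j) =
      {0, 5, 6, 7, 9, 10} by decide +kernel]
    simp [delPezzoExp, d3710, ← hV₃, d1502, ← hV₄, d3112, d1312, c0]
    linear_combination (c 5 * c 10 + c 7 * c 9) * h2
  have r513 : coeff (expVec ![5, 1, 3, 2]) (F * D) = c 3 * c 8 + c 7 * A := by
    rw [hF, coeff_delPezzo_mul,
      show (Finset.univ.filter fun i => ∀ j, delPezzoExp i j ≤ ![5, 1, 3, 2] j) =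
      {0, 1, 3, 4, 7, 8} by decide +kernel]
    simp [delPezzoExp, d5130, d5102, d4012, d3112, ← hA, d1122, c0]
    linear_combination (c 3 * c 8 + c 4 * c 7) * h2
  have r551 : coeff (expVec ![5, 5, 1, 2]) (F * D) = c 5 * V₂ + c 7 * V₃ := by
    rw [hF, coeff_delPezzo_mul,
      show (Finset.univ.filter fun i => ∀ j, delPezzoExp i j ≤ ![5, 5, 1, 2] j) =
      {0, 5, 6, 7, 8, 10, 11} by decide +kernel]
    simp [delPezzoExp, d5510, ← hV₂, d3302, ← hV₃, d1502, d3112, d1312, c0]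
    linear_combination (c 5 * c 11 + c 7 * c 10) * h2
  have r731 : coeff (expVec ![7, 3, 1, 2]) (F * D) = c 5 * V₁ + c 7 * V₂ := by
    rw [hF, coeff_delPezzo_mul,
      show (Finset.univ.filter fun i => ∀ j, delPezzoExp i j ≤ ![7, 3, 1, 2] j) =
      {0, 5, 6, 7, 8, 11, 12} by decide +kernel]
    simp [delPezzoExp, d7310, ← hV₁, d5102, ← hV₂, d3302, d3112, d1312, c0]
    linear_combination (c 5 * c 12 + c 7 * c 11) * h2
  have e := hFD ![3, 3, 3, 2] (by decide)
  rw [r333] at e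
  have e775 : B ^ 2 * (c 5 * V₁ + c 7 * V₂) + c 3 ^ 2 * (c 5 * V₂ + c 7 * V₃) +
      c 5 ^ 2 * (c 3 * c 8 + c 7 * A) + A ^ 2 * (c 5 * V₃ + c 7 * V₄) + c 6 ^ 2 * (c 3 * c 6 +
      c 5 * A + c 7 * B) + c 7 ^ 2 * (c 5 * B) = 0 := by
    have h := hFD3 ![7, 7, 5, 6] (by decide)
    rw [hF, hD, coeff_delPezzo_mul_delPezzoDelta_cube c hg, ← hF, ← hD,
      show ((Finset.Iic fun i => ![7, 7, 5, 6] i / 2).filter fun m =>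
        m 0 + m 1 + 2 * m 2 + 3 * m 3 = 12 ∧ Even (m 3)) =
        {![0, 2, 2, 2], ![1, 1, 2, 2], ![1, 3, 1, 2], ![2, 0, 2, 2], ![2, 2, 1, 2], ![3, 1, 1, 2],
          ![3, 3, 0, 2]} by decide +kernel] at h
    simp [← hB, d1122, d1312, ← hA, d2212, d3112, d3302, r115, r153, r333, r371, r513, r551, r731,
      c0] at h
    linear_combination h
  have e557 : c 1 ^ 2 * (c 5 * V₂ + c 7 * V₃) + B ^ 2 * (c 3 * c 8 + c 7 * A) +
      c 3 ^ 2 * (c 3 * c 6 + c 5 * A + c 7 * B) + A ^ 2 * (c 5 * B) +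
      c 6 ^ 2 * (c 1 * c 3) = 0 := by
    have h := hFD3 ![5, 5, 7, 6] (by decide)
    rw [hF, hD, coeff_delPezzo_mul_delPezzoDelta_cube c hg, ← hF, ← hD,
      show ((Finset.Iic fun i => ![5, 5, 7, 6] i / 2).filter fun m =>
        m 0 + m 1 + 2 * m 2 + 3 * m 3 = 12 ∧ Even (m 3)) =
        {![0, 0, 3, 2], ![0, 2, 2, 2], ![1, 1, 2, 2], ![2, 0, 2, 2],
          ![2, 2, 1, 2]} by decide +kernel] at h
    simp [d0032, ← hB, d1122, ← hA, d2212, r115, r153, r333, r513, r551, c0] at h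
    linear_combination h
  have e377 : c 1 ^ 2 * (c 5 * V₃ + c 7 * V₄) + B ^ 2 * (c 3 * c 6 + c 5 * A + c 7 * B) +
      c 3 ^ 2 * (c 5 * B) + c 5 ^ 2 * (c 1 * c 3) = 0 := by
    have h := hFD3 ![3, 7, 7, 6] (by decide)
    rw [hF, hD, coeff_delPezzo_mul_delPezzoDelta_cube c hg, ← hF, ← hD,
      show ((Finset.Iic fun i => ![3, 7, 7, 6] i / 2).filter fun m =>
        m 0 + m 1 + 2 * m 2 + 3 * m 3 = 12 ∧ Even (m 3)) =
        {![0, 0, 3, 2], ![0, 2, 2, 2], ![1, 1, 2, 2], ![1, 3, 1, 2]} by decide +kernel] at h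
    simp [d0032, ← hB, d1122, d1312, r115, r153, r333, r371, c0] at h
    linear_combination h
  have e737 : c 1 ^ 2 * (c 5 * V₁ + c 7 * V₂) + c 3 ^ 2 * (c 3 * c 8 + c 7 * A) +
      A ^ 2 * (c 3 * c 6 + c 5 * A + c 7 * B) + c 7 ^ 2 * (c 1 * c 3) = 0 := by
    have h := hFD3 ![7, 3, 7, 6] (by decide)
    rw [hF, hD, coeff_delPezzo_mul_delPezzoDelta_cube c hg, ← hF, ← hD,
      show ((Finset.Iic fun i => ![7, 3, 7, 6] i / 2).filter fun m =>
        m 0 + m 1 + 2 * m 2 + 3 * m 3 = 12 ∧ Even (m 3)) =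
        {![0, 0, 3, 2], ![1, 1, 2, 2], ![2, 0, 2, 2], ![3, 1, 1, 2]} by decide +kernel] at h
    simp [d0032, d1122, ← hA, d3112, r115, r333, r513, r731, c0] at h
    linear_combination h
  have c1 : c 1 = s₃ := by rw [hc]; rfl
  have c3 : c 3 = s₁ * q := by rw [hc]; rfl
  have c5 : c 5 = s₁ ^ 2 * q := by rw [hc]; rfl
  have c6 : c 6 = s₁ ^ 2 * (s₁ ^ 3 + s₃) := by rw [hc]; rfl
  have c7 : c 7 = s₁ ^ 2 * q := by rw [hc]; rfl
  have c8 : c 8 = s₁ ^ 2 * s₃ := by rw [hc]; rfl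
  rw [c3, c5, c6, c7] at e
  rw [c1, c3, c5, c6, c7, c8] at e557
  rw [c3, c5, c6, c7, c8] at e775
  rw [c1, c3, c5, c6, c7] at e377
  rw [c1, c3, c5, c6, c7, c8] at e737
  have hc5 : s₁ ^ 2 * q ≠ 0 := mul_ne_zero (pow_ne_zero 2 h₁) hq
  have f333 : A + B + s₁ * (s₁ ^ 3 + s₃) = 0 := by
    refine mul_left_cancel₀ hc5 ?_
    linear_combination e
  have f557 : s₃ ^ 2 * (V₂ + V₃) + B ^ 2 * (s₁ * s₃ + A) + A ^ 2 * B +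
      s₁ ^ 3 * s₃ * (s₁ ^ 3 + s₃) ^ 2 = 0 := by
    refine mul_left_cancel₀ hc5 ?_
    linear_combination e557 - (s₁ * q) ^ 2 * e
  have f377 : s₃ ^ 2 * (V₃ + V₄) + s₁ ^ 2 * q ^ 2 * (B + s₁ * s₃) = 0 := by
    refine mul_left_cancel₀ hc5 ?_
    linear_combination e377 - B ^ 2 * e
  have f737 : s₃ ^ 2 * (V₁ + V₂) + s₁ ^ 2 * q ^ 2 * A = 0 := by
    refine mul_left_cancel₀ hc5 ?_
    linear_combination e737 - A ^ 2 * e - s₁ ^ 5 * q ^ 3 * s₃ * h2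
  have f775 : B ^ 2 * (V₁ + V₂) + s₁ ^ 2 * q ^ 2 * (V₂ + V₃) + A ^ 2 * (V₃ + V₄) +
      s₁ ^ 4 * q ^ 2 * (s₁ * s₃ + A + B) = 0 := by
    refine mul_left_cancel₀ hc5 ?_
    linear_combination e775 - (s₁ ^ 2 * (s₁ ^ 3 + s₃)) ^ 2 * e
  have key : s₁ ^ 8 * q ^ 2 * s₃ ^ 2 = 0 := by
    linear_combination -s₃ ^ 2 * f775 + B ^ 2 * f737 + s₁ ^ 2 * q ^ 2 * f557 + A ^ 2 * f377 +
      s₁ ^ 2 * q ^ 2 * (s₃ ^ 2 * s₁ ^ 2 -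
        s₁ * s₃ * (A + B - s₁ * (s₁ ^ 3 + s₃))) * f333 -
      s₁ ^ 2 * q ^ 2 * (A * B ^ 2 + A ^ 2 * B - s₁ * s₃ * A * B +
        s₁ ^ 3 * s₃ * (s₁ ^ 3 + s₃) ^ 2) * h2
  exact mul_ne_zero (mul_ne_zero (pow_ne_zero _ h₁) (pow_ne_zero _ hq)) (pow_ne_zero _ h₃) key

lemma monomial_expVec_cons {R : Type*} [CommSemiring R] (i j l n : ℕ) (t : R) :
    monomial (expVec ![i, j, l, n]) t = C t * X 0 ^ i * X 1 ^ j * X 2 ^ l * X 3 ^ n := by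
  rw [monomial_eq, Finsupp.prod_fintype _ _ fun _ => pow_zero _, Fin.prod_univ_four]
  simp [mul_assoc]

end DelPezzo

/-- 8A₁ del Pezzo: every lift `W(k)[x,y,z,w]/(f+2G)` is 3-quasi-F-split.
With notation as in the 8A₁ setting: for every homogeneous `G ∈ S` of degree 6 (weights
`deg x = deg y = 1`, `deg z = 2`, `deg w = 3`) and every `D ∈ S` with
`2D = φ(f+2G) − (f+2G)²`, it is not the case that both
`ρ(f·D) ∈ (x⁴, y⁴, z⁴, w⁴)` and `ρ(f·D³) ∈ (x⁸, y⁸, z⁸, w⁸)`. -/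
theorem stmt8 (k : Type*) [Field k] [IsAlgClosed k] [CharP k 2]
    (φ : MvPolynomial (Fin 4) (WittVector 2 k) →+* MvPolynomial (Fin 4) (WittVector 2 k))
    (hφC : ∀ α : WittVector 2 k, φ (C α) = C (WittVector.frobenius α))
    (hφX : ∀ i : Fin 4, φ (X i) = X i ^ 2)
    (r : WittVector 2 k →+* k)
    (hr : ∀ α : WittVector 2 k, r α = α.coeff 0)
    (a b c : k) (habc : a * b * c * (a + b) * (b + c) * (c + a) * (a + b + c) ≠ 0)
    (f : MvPolynomial (Fin 4) (WittVector 2 k))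
    (hf : f = X 3 ^ 2
      + C (WittVector.teichmuller 2 (a * b * c)) * X 2 ^ 3
      + C (WittVector.teichmuller 2 ((a * b + b * c + c * a) ^ 2 + a * b * c * (a + b + c)))
          * X 1 ^ 2 * X 2 ^ 2
      + C (WittVector.teichmuller 2 ((a + b + c) * (a + b) * (b + c) * (c + a)))
          * X 0 * X 1 * X 2 ^ 2
      + C (WittVector.teichmuller 2 ((a * b + b * c + c * a) ^ 2)) * X 0 ^ 2 * X 2 ^ 2
      + C (WittVector.teichmuller 2 ((a + b + c) ^ 2 * (a + b) * (b + c) * (c + a)))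
          * X 0 * X 1 ^ 3 * X 2
      + C (WittVector.teichmuller 2 ((a + b + c) ^ 2 * ((a + b + c) ^ 3 + a * b * c)))
          * X 0 ^ 2 * X 1 ^ 2 * X 2
      + C (WittVector.teichmuller 2 ((a + b + c) ^ 2 * (a + b) * (b + c) * (c + a)))
          * X 0 ^ 3 * X 1 * X 2
      + C (WittVector.teichmuller 2 ((a + b + c) ^ 2 * (a * b * c))) * X 0 ^ 4 * X 2
      + C (WittVector.teichmuller 2 ((a + b) ^ 2 * (b + c) ^ 2 * (c + a) ^ 2)) * X 1 ^ 6
      + C (WittVector.teichmuller 2 (((a + b + c) ^ 3 + a * b * c) ^ 2)) * X 0 ^ 2 * X 1 ^ 4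
      + C (WittVector.teichmuller 2 ((a + b) ^ 2 * (b + c) ^ 2 * (c + a) ^ 2))
          * X 0 ^ 4 * X 1 ^ 2
      + C (WittVector.teichmuller 2 (a ^ 2 * b ^ 2 * c ^ 2)) * X 0 ^ 6)
    (G : MvPolynomial (Fin 4) (WittVector 2 k))
    (hG : MvPolynomial.IsWeightedHomogeneous (![1, 1, 2, 3] : Fin 4 → ℕ) G 6)
    (D : MvPolynomial (Fin 4) (WittVector 2 k))
    (hD : 2 * D = φ (f + 2 * G) - (f + 2 * G) ^ 2) :
    ¬ (MvPolynomial.map r (f * D)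
          ∈ Ideal.span ({X 0 ^ 4, X 1 ^ 4, X 2 ^ 4, X 3 ^ 4} : Set (MvPolynomial (Fin 4) k)) ∧
       MvPolynomial.map r (f * D ^ 3)
          ∈ Ideal.span ({X 0 ^ 8, X 1 ^ 8, X 2 ^ 8, X 3 ^ 8} : Set (MvPolynomial (Fin 4) k))) := by
  rintro ⟨hfD, hfD3⟩
  have h₁ : a + b + c ≠ 0 := right_ne_zero_of_mul habc
  have h₃ : a * b * c ≠ 0 := fun h => habc (by simp [h])
  have hq : (a + b) * (b + c) * (c + a) ≠ 0 := fun h => habc (by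
    linear_combination a * b * c * (a + b + c) * h)
  set e := delPezzoCoeff (a + b + c) (a * b + b * c + c * a) (a * b * c)
    ((a + b) * (b + c) * (c + a)) with he
  have hfe : f = ∑ i, monomial (expVec (delPezzoExp i)) (WittVector.teichmuller 2 (e i)) := by
    rw [hf]
    simp only [Fin.sum_univ_succ, he, delPezzoExp, delPezzoCoeff]
    simp [monomial_expVec_cons]
    ring_nf
  have hF : map r f = ∑ i, monomial (expVec (delPezzoExp i)) (e i) := by
    rw [hfe, map_sum]
    simp only [map_monomial, hr, WittVector.teichmuller_coeff_zero]
  refine not_forall_coeff_delPezzo_eq_zero h₁ h₃ hq (g := map r G) (fun m hm => ?_) he hF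
    (map_delta_eq hφC hφX hr (fun i => expVec (delPezzoExp i)) e hfe hD) (fun n hn => ?_)
    (fun n hn => ?_)
  · rw [coeff_map, hG.coeff_eq_zero, map_zero]
    intro h
    apply hm
    rw [← h]
    simp [Finsupp.weight_apply, Finsupp.sum_fintype, Fin.sum_univ_four, expVec, mul_comm]
  · rw [map_mul] at hfD
    exact coeff_eq_zero_of_mem_span_X_pow hfD hn
  · rw [map_mul, map_pow] at hfD3
    exact coeff_eq_zero_of_mem_span_X_pow hfD3 hn
end

section
/- For every homogeneous element G ∈ S of degree 6 and every D ∈ S with 2D = φ(f+2G) − (f+2G)², it is not the case that all three of the following hold: ρ(f·D) ∈ m^[4] = (x⁴, y⁴, z⁴, w⁴), ρ(f·D³) ∈ m^[8] = (x⁸, y⁸, z⁸, w⁸), and ρ(f·D⁷) ∈ m^[16] = (x¹⁶, y¹⁶, z¹⁶, w¹⁶). (This is the computational content of the statement that W(k)[x,y,z,w]/(f+2G) is 4-quasi-F-split for every homogeneous G of degree 6.) -/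
open MvPolynomial

namespace DelPezzo

section Coefficients

variable {R : Type*} [CommRing R]

/-- The exponent vector of `x ^ i * y ^ j * z ^ l * w ^ m`. -/
noncomputable def expo (i j l m : ℕ) : Fin 4 →₀ ℕ :=
  Finsupp.equivFunOnFinite.symm ![i, j, l, m]

/-- The monomial `u * x ^ i * y ^ j * z ^ l * w ^ m`. -/
noncomputable def mon (i j l m : ℕ) (u : R) : MvPolynomial (Fin 4) R :=
  monomial (expo i j l m) u

theorem expo_le_iff {i j l m i' j' l' m' : ℕ} :
    expo i j l m ≤ expo i' j' l' m' ↔ i ≤ i' ∧ j ≤ j' ∧ l ≤ l' ∧ m ≤ m' := by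
  simp [Finsupp.le_def, Fin.forall_fin_succ, expo]

theorem expo_inj {i j l m i' j' l' m' : ℕ} :
    expo i j l m = expo i' j' l' m' ↔ i = i' ∧ j = j' ∧ l = l' ∧ m = m' := by
  simp [expo]

theorem expo_sub (i j l m i' j' l' m' : ℕ) :
    expo i j l m - expo i' j' l' m' = expo (i - i') (j - j') (l - l') (m - m') := by
  ext t; fin_cases t <;> simp [expo]

theorem nsmul_expo (n i j l m : ℕ) :
    n • expo i j l m = expo (n * i) (n * j) (n * l) (n * m) := by
  ext t; fin_cases t <;> simp [expo]

theorem eq_expo (n : Fin 4 →₀ ℕ) : n = expo (n 0) (n 1) (n 2) (n 3) := by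
  ext t; fin_cases t <;> simp [expo]

theorem coeff_mon (i j l m i' j' l' m' : ℕ) (u : R) :
    coeff (expo i j l m) (mon i' j' l' m' u) =
      if i' = i ∧ j' = j ∧ l' = l ∧ m' = m then u else 0 := by
  simp [mon, coeff_monomial, expo_inj]

theorem coeff_mul_mon (i j l m i' j' l' m' : ℕ) (P : MvPolynomial (Fin 4) R) (u : R) :
    coeff (expo i j l m) (P * mon i' j' l' m' u) =
      if i' ≤ i ∧ j' ≤ j ∧ l' ≤ l ∧ m' ≤ m then
        coeff (expo (i - i') (j - j') (l - l') (m - m')) P * u else 0 := by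
  simp [mon, coeff_mul_monomial', expo_le_iff, expo_sub]

theorem mon_pow (i j l m n : ℕ) (u : R) :
    mon i j l m u ^ n = mon (n * i) (n * j) (n * l) (n * m) (u ^ n) := by
  simp [mon, monomial_pow, nsmul_expo]

theorem mon_eq (i j l m : ℕ) (u : R) :
    mon i j l m u = C u * X 0 ^ i * X 1 ^ j * X 2 ^ l * X 3 ^ m := by
  rw [mon, monomial_eq, Finsupp.prod_fintype _ _ (by simp)]
  simp [Fin.prod_univ_four, expo, mul_assoc]

theorem coeff_eq_zero_of_mem_span {q i j l m : ℕ} {P : MvPolynomial (Fin 4) R}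
    (hP : P ∈ Ideal.span ({X 0 ^ q, X 1 ^ q, X 2 ^ q, X 3 ^ q} : Set (MvPolynomial (Fin 4) R)))
    (hi : i < q) (hj : j < q) (hl : l < q) (hm : m < q) :
    coeff (expo i j l m) P = 0 := by
  have h0 : (X 0 ^ q : MvPolynomial (Fin 4) R) = mon q 0 0 0 1 := by simp [mon_eq]
  have h1 : (X 1 ^ q : MvPolynomial (Fin 4) R) = mon 0 q 0 0 1 := by simp [mon_eq]
  have h2 : (X 2 ^ q : MvPolynomial (Fin 4) R) = mon 0 0 q 0 1 := by simp [mon_eq]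
  have h3 : (X 3 ^ q : MvPolynomial (Fin 4) R) = mon 0 0 0 q 1 := by simp [mon_eq]
  rw [h0, h1, h2, h3] at hP
  simp only [Ideal.mem_span_insert, Ideal.mem_span_singleton'] at hP
  obtain ⟨A, _, ⟨B, _, ⟨E, _, ⟨F, rfl⟩, rfl⟩, rfl⟩, rfl⟩ := hP
  simp [coeff_mul_mon, hi.not_ge, hj.not_ge, hl.not_ge, hm.not_ge]

theorem eq_sum_mon_of_isWeightedHomogeneous {g : MvPolynomial (Fin 4) R}
    (hg : IsWeightedHomogeneous (![1, 1, 2, 3] : Fin 4 → ℕ) g 6) :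
    g =
      mon 0 6 0 0 (coeff (expo 0 6 0 0) g) + mon 1 5 0 0 (coeff (expo 1 5 0 0) g) +
      mon 2 4 0 0 (coeff (expo 2 4 0 0) g) + mon 3 3 0 0 (coeff (expo 3 3 0 0) g) +
      mon 4 2 0 0 (coeff (expo 4 2 0 0) g) + mon 5 1 0 0 (coeff (expo 5 1 0 0) g) +
      mon 6 0 0 0 (coeff (expo 6 0 0 0) g) + mon 0 4 1 0 (coeff (expo 0 4 1 0) g) +
      mon 1 3 1 0 (coeff (expo 1 3 1 0) g) + mon 2 2 1 0 (coeff (expo 2 2 1 0) g) +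
      mon 3 1 1 0 (coeff (expo 3 1 1 0) g) + mon 4 0 1 0 (coeff (expo 4 0 1 0) g) +
      mon 0 2 2 0 (coeff (expo 0 2 2 0) g) + mon 1 1 2 0 (coeff (expo 1 1 2 0) g) +
      mon 2 0 2 0 (coeff (expo 2 0 2 0) g) + mon 0 0 3 0 (coeff (expo 0 0 3 0) g) +
      mon 0 3 0 1 (coeff (expo 0 3 0 1) g) + mon 1 2 0 1 (coeff (expo 1 2 0 1) g) +
      mon 2 1 0 1 (coeff (expo 2 1 0 1) g) + mon 3 0 0 1 (coeff (expo 3 0 0 1) g) +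
      mon 0 1 1 1 (coeff (expo 0 1 1 1) g) + mon 1 0 1 1 (coeff (expo 1 0 1 1) g) +
      mon 0 0 0 2 (coeff (expo 0 0 0 2) g) := by
  ext n
  rw [eq_expo n]
  generalize n 0 = i, n 1 = j, n 2 = l, n 3 = m
  by_cases h : i + j + 2 * l + 3 * m = 6
  · have hm : m ≤ 2 := by omega
    have hl : l ≤ 3 := by omega
    have hj : j ≤ 6 := by omega
    obtain rfl : i = 6 - (j + 2 * l + 3 * m) := by omega
    interval_cases m <;> interval_cases l <;> interval_cases j <;>
      first
      | (exfalso; omega)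
      | simp [coeff_mon]
  · have h0 : coeff (expo i j l m) g = 0 := by
      refine hg.coeff_eq_zero _ fun hw => h ?_
      rw [← hw, Finsupp.weight_apply, Finsupp.sum_fintype _ _ (by simp)]
      simp [Fin.sum_univ_four, expo]
      ring
    rw [h0]
    symm
    simp only [coeff_add, coeff_mon]
    repeat rw [if_neg (by omega)]
    simp

end Coefficients

section Reduction

variable {k : Type*} [Field k]

/-- The reduction of the del Pezzo equation. -/
noncomputable def eqn (a : k) : MvPolynomial (Fin 4) k :=
  mon 0 0 0 2 1 + mon 0 0 3 0 1 + mon 2 0 2 0 a + mon 0 4 1 0 1 +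
    mon 2 2 1 0 (a ^ 2 + a + 1) + mon 3 1 1 0 (a * (a + 1))

/-- The sum of the products of two distinct terms of the del Pezzo equation. -/
noncomputable def crossTerms (a : k) : MvPolynomial (Fin 4) k :=
  mon 0 0 3 2 1 + mon 2 0 2 2 a + mon 2 0 5 0 a +
    mon 0 4 1 2 1 + mon 0 4 4 0 1 + mon 2 4 3 0 a +
    mon 2 2 1 2 (a ^ 2 + a + 1) + mon 2 2 4 0 (a ^ 2 + a + 1) + mon 4 2 3 0 (a * (a ^ 2 + a + 1)) +
    mon 2 6 2 0 (a ^ 2 + a + 1) + mon 3 1 1 2 (a * (a + 1)) + mon 3 1 4 0 (a * (a + 1)) +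
    mon 5 1 3 0 (a * (a * (a + 1))) + mon 3 5 2 0 (a * (a + 1)) +
    mon 5 3 2 0 ((a ^ 2 + a + 1) * (a * (a + 1)))

theorem coeff_eqn_mul (a : k) (i j l m : ℕ) (P : MvPolynomial (Fin 4) k) :
    coeff (expo i j l m) (eqn a * P) =
      coeff (expo i j l m) (P * mon 0 0 0 2 1) + coeff (expo i j l m) (P * mon 0 0 3 0 1) +
      coeff (expo i j l m) (P * mon 2 0 2 0 a) + coeff (expo i j l m) (P * mon 0 4 1 0 1) +
      coeff (expo i j l m) (P * mon 2 2 1 0 (a ^ 2 + a + 1)) +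
      coeff (expo i j l m) (P * mon 3 1 1 0 (a * (a + 1))) := by
  simp only [eqn, add_mul, coeff_add, mul_comm P]

variable [CharP k 2]

/-- Four of the coefficients outside the Frobenius powers of the maximal ideal cannot vanish
simultaneously. -/
theorem not_fedder {a : k} (ha : a * (a + 1) ≠ 0) {g : MvPolynomial (Fin 4) k}
    (hg : IsWeightedHomogeneous (![1, 1, 2, 3] : Fin 4 → ℕ) g 6)
    {D : MvPolynomial (Fin 4) k} (hD : D = crossTerms a + g ^ 2)
    (h₁ : coeff (expo 3 3 3 2) (eqn a * D) = 0)
    (h₂ : coeff (expo 7 5 6 6) (eqn a * D ^ 3) = 0)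
    (h₃ : coeff (expo 5 5 7 6) (eqn a * D ^ 3) = 0)
    (h₄ : coeff (expo 15 13 10 14) (eqn a * D ^ 7) = 0) : False := by
  rw [eq_sum_mon_of_isWeightedHomogeneous hg] at hD
  simp only [crossTerms, CharTwo.add_sq, mon_pow, Nat.reduceMul] at hD
  have hD2 := congrArg (· ^ 2) hD
  simp only [CharTwo.add_sq, mon_pow, ← pow_mul, Nat.reduceMul] at hD2
  have hD4 := congrArg (· ^ 2) hD2
  simp only [CharTwo.add_sq, mon_pow, ← pow_mul, Nat.reduceMul] at hD4
  have e3 : eqn a * D ^ 3 = eqn a * D * D ^ 2 := by ring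
  have e7 : eqn a * D ^ 7 = eqn a * D * D ^ 2 * D ^ 4 := by ring
  rw [e3, hD2] at h₂ h₃
  rw [e7, hD4, hD2] at h₄
  simp [mul_add, coeff_mul_mon, coeff_eqn_mul] at h₁ h₂ h₃ h₄
  simp [hD, coeff_mon] at h₁ h₂ h₃ h₄
  clear hD hD2 hD4 e3 e7
  generalize coeff (expo 0 1 1 1) g = p at *
  generalize coeff (expo 1 0 1 1) g = q at *
  generalize coeff (expo 1 2 0 1) g = s at *
  generalize coeff (expo 3 0 0 1) g = t at *
  have h2 : (2 : k) = 0 := CharTwo.two_eq_zero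
  obtain rfl : p = 0 := by
    have h : a * (a + 1) * p ^ 2 = 0 := by linear_combination h₁
    simpa [ha] using h
  obtain rfl : s = 0 := by
    have h : a * (a + 1) * s ^ 2 = 0 := by linear_combination h₃
    simpa [ha] using h
  have hq : 1 + a ^ 4 + q ^ 4 = 0 := by
    have h : a * (a + 1) * (1 + a ^ 4 + q ^ 4) = 0 := by
      linear_combination h₂ - a * (a + 1) * (1 + a ^ 4 + q ^ 4 + 3 * a ^ 2) * h2
    exact (mul_eq_zero.1 h).resolve_left ha
  refine pow_ne_zero 5 ha ?_
  linear_combination h₄ - 3 * a * (a + 1) * (a ^ 8 + a ^ 4 + 1) * (hq + a ^ 2 * h2)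
    - (a * (a + 1)) ^ 5 * h2

/-- The reduction modulo 2 of `φ` is the squaring map. -/
theorem map_frobeniusLift
    {φ : MvPolynomial (Fin 4) (WittVector 2 k) →+* MvPolynomial (Fin 4) (WittVector 2 k)}
    (hφC : ∀ α : WittVector 2 k, φ (C α) = C (WittVector.frobenius α))
    (hφX : ∀ i : Fin 4, φ (X i) = X i ^ 2)
    {r : WittVector 2 k →+* k} (hr : ∀ α : WittVector 2 k, r α = α.coeff 0)
    (P : MvPolynomial (Fin 4) (WittVector 2 k)) :
    MvPolynomial.map r (φ P) = MvPolynomial.map r P ^ 2 := by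
  have h : (MvPolynomial.map r).comp φ =
      (frobenius (MvPolynomial (Fin 4) k) 2).comp (MvPolynomial.map r) := by
    apply MvPolynomial.ringHom_ext
    · intro α
      simp [hφC, hr, WittVector.coeff_frobenius_charP, frobenius_def]
    · intro i
      simp [hφX, frobenius_def]
  exact DFunLike.congr_fun h P

theorem frobenius_teichmuller (α : k) :
    WittVector.frobenius (WittVector.teichmuller 2 α) = WittVector.teichmuller 2 α ^ 2 := by
  rw [WittVector.frobenius_eq_map_frobenius, WittVector.map_teichmuller, frobenius_def, map_pow]

/-- The reduction modulo 2 of the delta map at `f + 2 * G`. -/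
theorem map_delta
    {φ : MvPolynomial (Fin 4) (WittVector 2 k) →+* MvPolynomial (Fin 4) (WittVector 2 k)}
    (hφC : ∀ α : WittVector 2 k, φ (C α) = C (WittVector.frobenius α))
    (hφX : ∀ i : Fin 4, φ (X i) = X i ^ 2)
    {r : WittVector 2 k →+* k} (hr : ∀ α : WittVector 2 k, r α = α.coeff 0)
    {a : k} {f G D : MvPolynomial (Fin 4) (WittVector 2 k)}
    (hf : f = X 3 ^ 2 + X 2 ^ 3
      + C (WittVector.teichmuller 2 a) * X 0 ^ 2 * X 2 ^ 2
      + X 1 ^ 4 * X 2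
      + C (WittVector.teichmuller 2 (a ^ 2 + a + 1)) * X 0 ^ 2 * X 1 ^ 2 * X 2
      + C (WittVector.teichmuller 2 (a * (a + 1))) * X 0 ^ 3 * X 1 * X 2)
    (hD : 2 * D = φ (f + 2 * G) - (f + 2 * G) ^ 2) :
    MvPolynomial.map r D = crossTerms a + MvPolynomial.map r G ^ 2 := by
  have hT (α : k) : φ (C (WittVector.teichmuller 2 α)) = C (WittVector.teichmuller 2 α) ^ 2 := by
    rw [hφC, frobenius_teichmuller, map_pow]
  have hrT (α : k) : r (WittVector.teichmuller 2 α) = α := by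
    rw [hr, WittVector.teichmuller_coeff_zero]
  have h2 : (2 : MvPolynomial (Fin 4) (WittVector 2 k)) ≠ 0 := by
    have h := (C_injective (Fin 4) (WittVector 2 k)).ne (WittVector.p_nonzero 2 k)
    rwa [C_0, Nat.cast_ofNat, map_ofNat] at h
  let S (A B E : MvPolynomial (Fin 4) (WittVector 2 k)) :
      MvPolynomial (Fin 4) (WittVector 2 k) :=
    X 2 ^ 3 * X 3 ^ 2 + A * X 0 ^ 2 * X 2 ^ 2 * X 3 ^ 2 + A * X 0 ^ 2 * X 2 ^ 5 +
      X 1 ^ 4 * X 2 ^ 1 * X 3 ^ 2 + X 1 ^ 4 * X 2 ^ 4 + A * X 0 ^ 2 * X 1 ^ 4 * X 2 ^ 3 +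
      B * X 0 ^ 2 * X 1 ^ 2 * X 2 ^ 1 * X 3 ^ 2 +
      B * X 0 ^ 2 * X 1 ^ 2 * X 2 ^ 4 +
      A * B * X 0 ^ 4 * X 1 ^ 2 * X 2 ^ 3 +
      B * X 0 ^ 2 * X 1 ^ 6 * X 2 ^ 2 + E * X 0 ^ 3 * X 1 ^ 1 * X 2 ^ 1 * X 3 ^ 2 +
      E * X 0 ^ 3 * X 1 ^ 1 * X 2 ^ 4 +
      A * E * X 0 ^ 5 * X 1 ^ 1 * X 2 ^ 3 + E * X 0 ^ 3 * X 1 ^ 5 * X 2 ^ 2 +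
      B * E * X 0 ^ 5 * X 1 ^ 3 * X 2 ^ 2
  have key : D = φ G - 2 * (f * G) - 2 * G ^ 2 - S (C (WittVector.teichmuller 2 a))
      (C (WittVector.teichmuller 2 (a ^ 2 + a + 1)))
      (C (WittVector.teichmuller 2 (a * (a + 1)))) := by
    apply mul_left_cancel₀ h2
    rw [hD]
    simp only [map_add, map_mul, map_pow, map_ofNat, hf, hφX, hT, S]
    ring
  have hk : (2 : MvPolynomial (Fin 4) k) = 0 := CharTwo.two_eq_zero
  rw [key]
  simp only [map_sub, map_mul, map_ofNat, hk, zero_mul,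
    map_frobeniusLift hφC hφX hr, CharTwo.sub_eq_add, S, crossTerms, mon_eq, map_add, map_pow,
    map_X, map_C, hrT, map_one]
  ring

end Reduction

end DelPezzo

/-- 4A₁+D₄ del Pezzo: every lift `W(k)[x,y,z,w]/(f+2G)` is
4-quasi-F-split. With notation as in the 4A₁+D₄ setting: for every homogeneous `G ∈ S`
of degree 6 (weights `deg x = deg y = 1`, `deg z = 2`, `deg w = 3`) and every `D ∈ S` with
`2D = φ(f+2G) − (f+2G)²`, it is not the case that all three of
`ρ(f·D) ∈ (x⁴, y⁴, z⁴, w⁴)`, `ρ(f·D³) ∈ (x⁸, y⁸, z⁸, w⁸)` and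
`ρ(f·D⁷) ∈ (x¹⁶, y¹⁶, z¹⁶, w¹⁶)` hold. -/
theorem stmt13 (k : Type*) [Field k] [IsAlgClosed k] [CharP k 2]
    (φ : MvPolynomial (Fin 4) (WittVector 2 k) →+* MvPolynomial (Fin 4) (WittVector 2 k))
    (hφC : ∀ α : WittVector 2 k, φ (C α) = C (WittVector.frobenius α))
    (hφX : ∀ i : Fin 4, φ (X i) = X i ^ 2)
    (r : WittVector 2 k →+* k)
    (hr : ∀ α : WittVector 2 k, r α = α.coeff 0)
    (a : k) (ha : a * (a + 1) ≠ 0)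
    (f : MvPolynomial (Fin 4) (WittVector 2 k))
    (hf : f = X 3 ^ 2 + X 2 ^ 3
      + C (WittVector.teichmuller 2 a) * X 0 ^ 2 * X 2 ^ 2
      + X 1 ^ 4 * X 2
      + C (WittVector.teichmuller 2 (a ^ 2 + a + 1)) * X 0 ^ 2 * X 1 ^ 2 * X 2
      + C (WittVector.teichmuller 2 (a * (a + 1))) * X 0 ^ 3 * X 1 * X 2)
    (G : MvPolynomial (Fin 4) (WittVector 2 k))
    (hG : MvPolynomial.IsWeightedHomogeneous (![1, 1, 2, 3] : Fin 4 → ℕ) G 6)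
    (D : MvPolynomial (Fin 4) (WittVector 2 k))
    (hD : 2 * D = φ (f + 2 * G) - (f + 2 * G) ^ 2) :
    ¬ (MvPolynomial.map r (f * D)
          ∈ Ideal.span ({X 0 ^ 4, X 1 ^ 4, X 2 ^ 4, X 3 ^ 4} : Set (MvPolynomial (Fin 4) k)) ∧
       MvPolynomial.map r (f * D ^ 3)
          ∈ Ideal.span ({X 0 ^ 8, X 1 ^ 8, X 2 ^ 8, X 3 ^ 8} : Set (MvPolynomial (Fin 4) k)) ∧
       MvPolynomial.map r (f * D ^ 7)
          ∈ Ideal.span ({X 0 ^ 16, X 1 ^ 16, X 2 ^ 16, X 3 ^ 16} : Set (MvPolynomial (Fin 4) k))) := by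
  rintro ⟨h₁, h₂, h₃⟩
  have hfr : MvPolynomial.map r f = DelPezzo.eqn a := by
    rw [hf]
    simp [DelPezzo.eqn, DelPezzo.mon_eq, hr, WittVector.teichmuller_coeff_zero]
  simp only [map_mul, map_pow, hfr] at h₁ h₂ h₃
  have hg : IsWeightedHomogeneous (![1, 1, 2, 3] : Fin 4 → ℕ) (MvPolynomial.map r G) 6 := by
    intro d hd
    refine hG fun h => hd ?_
    rw [coeff_map, h, map_zero]
  exact DelPezzo.not_fedder ha hg (DelPezzo.map_delta hφC hφX hr hf hD)
    (DelPezzo.coeff_eq_zero_of_mem_span h₁ (by decide) (by decide) (by decide) (by decide))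
    (DelPezzo.coeff_eq_zero_of_mem_span h₂ (by decide) (by decide) (by decide) (by decide))
    (DelPezzo.coeff_eq_zero_of_mem_span h₂ (by decide) (by decide) (by decide) (by decide))
    (DelPezzo.coeff_eq_zero_of_mem_span h₃ (by decide) (by decide) (by decide) (by decide))
end
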